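/- Let S be a unital ring and let 1_S = e₁ + ⋯ + e_n be a decomposition of 1_S into a sum of orthogonal idempotents. Let U be a subgroup of the group of units of S such that conjugation by elements of U permutes the set {e₁, …, e_n} and this action of U on {e₁, …, e_n} is transitive. Then S ≅ M_n(e₁ S e₁), the ring of n×n matrices over the corner ring e₁ S e₁. -/

import Mathlib

noncomputable section

/-- The corner `e S e = { e y e | y ∈ S }` of a ring, as a non-unital subring.
When `e` is idempotent this is a unital ring with identity `e`. -/
def cornerSubring {S : Type*} [Ring S] (e : S) : NonUnitalSubring S where
  carrier := {x | ∃ y : S, x = e * y * e}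
  add_mem' := by
    rintro a b ⟨y, rfl⟩ ⟨z, rfl⟩
    exact ⟨y + z, by noncomm_ring⟩
  zero_mem' := ⟨0, by simp⟩
  neg_mem' := by
    rintro a ⟨y, rfl⟩
    exact ⟨-y, by noncomm_ring⟩
  mul_mem' := by
    rintro a b ⟨y, rfl⟩ ⟨z, rfl⟩
    exact ⟨y * (e * e) * z, by noncomm_ring⟩

theorem mul_left_of_mul_eq_ite {S ι : Type*} [Ring S] [Fintype ι] [DecidableEq ι]
    {f : S} {a b : ι → S} (hba : ∀ i j, b i * a j = if i = j then f else 0)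
    (hab : ∑ i, a i * b i = 1) (i : ι) : f * b i = b i := by
  calc f * b i = b i * ∑ j, a j * b j := by simp [Finset.mul_sum, ← mul_assoc, hba]
    _ = b i := by rw [hab, mul_one]

theorem mul_right_of_mul_eq_ite {S ι : Type*} [Ring S] [Fintype ι] [DecidableEq ι]
    {f : S} {a b : ι → S} (hba : ∀ i j, b i * a j = if i = j then f else 0)
    (hab : ∑ i, a i * b i = 1) (j : ι) : a j * f = a j := by
  calc a j * f = (∑ i, a i * b i) * a j := by simp [Finset.sum_mul, mul_assoc, hba]
    _ = a j := by rw [hab, one_mul]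

/-- If `b i * a j` is `f` for `i = j` and `0` otherwise, and `∑ a i * b i = 1`, then `S` is a
matrix ring over the corner `f S f`, through `s ↦ (b i * s * a j)`. -/
def ringEquivMatrixCorner {S ι : Type*} [Ring S] [Fintype ι] [DecidableEq ι]
    {f : S} {a b : ι → S} (hba : ∀ i j, b i * a j = if i = j then f else 0)
    (hab : ∑ i, a i * b i = 1) : S ≃+* Matrix ι ι (cornerSubring f) where
  toFun s := Matrix.of fun i j => ⟨b i * s * a j, b i * s * a j, by
    calc b i * s * a j = f * b i * s * (a j * f) := by
          rw [mul_left_of_mul_eq_ite hba hab, mul_right_of_mul_eq_ite hba hab]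
      _ = f * (b i * s * a j) * f := by simp only [mul_assoc]⟩
  invFun M := ∑ i, ∑ j, a i * (M i j : S) * b j
  left_inv s := by
    calc ∑ i, ∑ j, a i * (b i * s * a j) * b j
        = (∑ i, a i * b i) * s * ∑ j, a j * b j := by
          simp only [Finset.sum_mul, Finset.mul_sum, mul_assoc]
          exact Finset.sum_comm
      _ = s := by rw [hab, one_mul, mul_one]
  right_inv M := by
    ext k l
    obtain ⟨y, hy⟩ := (M k l).2
    have hf : f * f = f := by
      nth_rewrite 2 [show f = b k * a k by simp [hba]]
      rw [← mul_assoc, mul_left_of_mul_eq_ite hba hab]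
      simp [hba]
    calc b k * (∑ i, ∑ j, a i * (M i j : S) * b j) * a l
        = ∑ i, ∑ j, (b k * a i) * (M i j : S) * (b j * a l) := by
          simp only [Finset.sum_mul, Finset.mul_sum, mul_assoc]
      _ = f * (M k l : S) * f := by simp [hba]
      _ = (f * f) * y * (f * f) := by rw [hy]; simp only [mul_assoc]
      _ = (M k l : S) := by rw [hf, hy]
  map_mul' s t := by
    ext i j
    simp only [Matrix.mul_apply, Matrix.of_apply, AddSubmonoidClass.coe_finsetSum,
      NonUnitalSubring.val_mul]
    calc b i * (s * t) * a j = b i * s * (∑ k, a k * b k) * t * a j := by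
          rw [hab]; simp only [mul_assoc, one_mul]
      _ = ∑ k, b i * s * a k * (b k * t * a j) := by
          simp only [Finset.sum_mul, Finset.mul_sum, mul_assoc]
  map_add' s t := by
    ext i j
    simp [mul_add, add_mul]

/-- **Passman's lemma.**  Let `S` be a unital ring and `1 = e₁ + ⋯ + eₙ` a
decomposition of `1` into a sum of orthogonal idempotents.  If a subgroup `U`
of the group of units of `S` permutes `{e₁, …, eₙ}` transitively by
conjugation, then `S ≅ Mₙ(e₁ S e₁)`. -/
theorem passman_matrix_lemma {S : Type*} [Ring S] {n : ℕ} (hn : 0 < n)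
    (e : Fin n → S)
    (hidem : ∀ i, IsIdempotentElem (e i))
    (horth : ∀ i j, i ≠ j → e i * e j = 0)
    (hsum : (∑ i, e i) = 1)
    (U : Subgroup Sˣ)
    (hperm : ∀ u ∈ U, ∀ i, ∃ j, (u : S) * e i * ((u⁻¹ : Sˣ) : S) = e j)
    (htrans : ∀ i j, ∃ u ∈ U, (u : S) * e i * ((u⁻¹ : Sˣ) : S) = e j) :
    Nonempty
      (S ≃+* Matrix (Fin n) (Fin n) (cornerSubring (e ⟨0, hn⟩))) := by
  choose u _ hu using htrans ⟨0, hn⟩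
  set f := e ⟨0, hn⟩
  have hue (i) : (u i : S) * f = e i * u i := by
    rw [← hu i, Units.inv_mul_cancel_right]
  refine ⟨ringEquivMatrixCorner (f := f) (a := fun i => e i * u i)
    (b := fun i => ((u i)⁻¹ : Sˣ) * e i) (fun i j => ?_) ?_⟩
  · split_ifs with h
    · subst h
      rw [mul_assoc, ← mul_assoc (e i), (hidem i).eq, ← hue, Units.inv_mul_cancel_left]
    · rw [mul_assoc, ← mul_assoc (e i), horth i j h, zero_mul, mul_zero]
  · rw [← hsum]
    refine Finset.sum_congr rfl fun i _ => ?_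
    rw [mul_assoc, Units.mul_inv_cancel_left, (hidem i).eq]
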